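/- Let P be a graded simplicial poset of rank n. Then for every S ⊆ [n], β_{P̂}(S) = Σ_{k=0}^n h_k(P) · #{w ∈ S_{n+1} : w(n+1) = k+1 and [n] ∖ Des(w) = S}, where Des(w) = {i ∈ [n] : w(i) > w(i+1)} for w ∈ S_{n+1}. -/

import Mathlib

open Polynomial

open scoped Classical

noncomputable section

/-- The descent set of a permutation `w` of `Fin n`, recorded as a subset of
`{1, ..., n-1}` (1-based positions, as in the paper: `i ∈ Des(w)` iff `w(i) > w(i+1)`). -/
def descSet {n : ℕ} (w : Equiv.Perm (Fin n)) : Finset ℕ :=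
  (Finset.univ.filter (fun i : Fin (n - 1) =>
      w ⟨i.val + 1, by have := i.isLt; omega⟩ < w ⟨i.val, by have := i.isLt; omega⟩)).image
    (fun i => i.val + 1)

/-- `A^T_n(x) = Σ_{w ∈ S_n, Des(w) ⊆ T} x^{des(w)}` (note `Des(w) ⊆ {1,...,n-1}`
automatically, so this also realizes the convention `A^T_n := A^{T ∩ [n-1]}_n`). -/
def Apoly (n : ℕ) (T : Finset ℕ) : Polynomial ℝ :=
  ∑ w ∈ Finset.univ.filter (fun w : Equiv.Perm (Fin n) => descSet w ⊆ T),
    X ^ (descSet w).card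

/-- `p^T_{n,k}(x) = Σ x^{des(w)}` over permutations `w ∈ S_{n+1}` with `w(1) = k+1`
(0-based: `w 0 = k`) and `Des(w) ⊆ T`. -/
def ppoly (n k : ℕ) (T : Finset ℕ) : Polynomial ℝ :=
  ∑ w ∈ Finset.univ.filter (fun w : Equiv.Perm (Fin (n + 1)) =>
      (w 0 : ℕ) = k ∧ descSet w ⊆ T),
    X ^ (descSet w).card

/-- A real polynomial has only real roots (or is identically zero). -/
def RealRooted (p : Polynomial ℝ) : Prop :=
  p = 0 ∨ ∀ z : ℂ, Polynomial.aeval z p = 0 → z.im = 0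

/-- The list of real roots of `p`, with multiplicity, in decreasing order. -/
def rootsDesc (p : Polynomial ℝ) : List ℝ :=
  (p.roots.sort (· ≤ ·)).reverse

/-- `Interlaces p q` means `p ⪯ q`: both are real-rooted and, listing the roots of `p`
as `α_1 ≥ α_2 ≥ ⋯` and those of `q` as `β_1 ≥ β_2 ≥ ⋯`, one has
`⋯ ≤ α_2 ≤ β_2 ≤ α_1 ≤ β_1`; by convention the zero polynomial interlaces and is
interlaced by every real-rooted polynomial. -/
def Interlaces (p q : Polynomial ℝ) : Prop :=
  (p = 0 ∧ RealRooted q) ∨ (q = 0 ∧ RealRooted p) ∨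
  (RealRooted p ∧ RealRooted q ∧
    Multiset.card q.roots ≤ Multiset.card p.roots + 1 ∧
    Multiset.card p.roots ≤ Multiset.card q.roots ∧
    (∀ (i : ℕ) (hp : i < (rootsDesc p).length) (hq : i < (rootsDesc q).length),
      (rootsDesc p).get ⟨i, hp⟩ ≤ (rootsDesc q).get ⟨i, hq⟩) ∧
    (∀ (i : ℕ) (hq : i + 1 < (rootsDesc q).length) (hp : i < (rootsDesc p).length),
      (rootsDesc q).get ⟨i + 1, hq⟩ ≤ (rootsDesc p).get ⟨i, hp⟩))

/-- The `T`-rank-selected subposet `P̂_T` of `P̂ = P ∪ {1̂}` (realized inside `WithTop P`):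
it consists of `0̂ = ⊥`, `1̂ = ⊤` and all elements of `P` whose rank lies in `T`. -/
def rankSel (P : Type*) [PartialOrder P] [OrderBot P] (ρ : P → ℕ) (T : Finset ℕ) :
    Set (WithTop P) :=
  {z | z = ⊤ ∨ z = ((⊥ : P) : WithTop P) ∨ ∃ y : P, z = (y : WithTop P) ∧ ρ y ∈ T}

/-- `α_{P̂}(T)`: the number of maximal chains of the rank-selected subposet `P̂_T`. -/
def alphaP (P : Type*) [PartialOrder P] [OrderBot P] (ρ : P → ℕ) (T : Finset ℕ) : ℕ :=
  Set.ncard {C : Set ↥(rankSel P ρ T) | IsMaxChain (· ≤ ·) C}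

/-- `β_{P̂}(T) = Σ_{S ⊆ T} (-1)^{|T∖S|} α_{P̂}(S)`. -/
def betaP (P : Type*) [PartialOrder P] [OrderBot P] (ρ : P → ℕ) (T : Finset ℕ) : ℤ :=
  ∑ S ∈ T.powerset, (-1 : ℤ) ^ (T.card - S.card) * (alphaP P ρ S : ℤ)

/-- The `h`-polynomial `h(P,x) = Σ_{i=0}^n f_{i-1}(P) x^i (1-x)^{n-i}` of a (graded,
rank `n`) simplicial poset `P`, where `f_{i-1}(P)` is the number of elements of rank `i`. -/
def hpolyP (P : Type*) [Fintype P] [PartialOrder P] (ρ : P → ℕ) (n : ℕ) : Polynomial ℤ :=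
  ∑ i ∈ Finset.range (n + 1),
    C (((Finset.univ.filter (fun y : P => ρ y = i)).card : ℤ)) * X ^ i * (1 - X) ^ (n - i)


/-! ### Auxiliary material -/

lemma aux_mobius (S : Finset ℕ) : ∀ b : Finset ℕ → ℤ,
    ∑ U ∈ S.powerset, (-1 : ℤ) ^ (S.card - U.card) * ∑ V ∈ U.powerset, b V = b S := by
  induction S using Finset.induction_on with
  | empty => intro b; simp
  | insert a S ha ih =>
    intro b
    rw [Finset.sum_powerset_insert ha]
    rw [← ih (fun V => b (insert a V)), ← Finset.sum_add_distrib]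
    apply Finset.sum_congr rfl
    intro U hU
    rw [Finset.mem_powerset] at hU
    have haU : a ∉ U := fun h => ha (hU h)
    have hc := Finset.card_le_card hU
    rw [Finset.sum_powerset_insert haU, Finset.card_insert_of_notMem ha,
      Finset.card_insert_of_notMem haU]
    have e1 : S.card + 1 - U.card = (S.card - U.card) + 1 := by omega
    have e2 : S.card + 1 - (U.card + 1) = S.card - U.card := by omega
    rw [e1, e2, pow_succ]
    ring

lemma aux_h1 (l : ℕ) : ∀ r : ℕ,
    ∑ k ∈ Finset.range (l + 1), ((1 - X : ℤ[X]) ^ l).coeff k * ((l - k).choose r : ℤ)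
      = if r = l then 1 else 0 := by
  induction l with
  | zero => intro r; cases r <;> simp
  | succ l ih =>
    intro r
    have hdeg : ((1 - X : ℤ[X]) ^ l).coeff (l + 1) = 0 := by
      apply Polynomial.coeff_eq_zero_of_natDegree_lt
      have : ((1 - X : ℤ[X]) ^ l).natDegree ≤ l * 1 :=
        Polynomial.natDegree_pow_le_of_le l (by
          apply (Polynomial.natDegree_sub_le _ _).trans; simp)
      omega
    have hq : (1 - X : ℤ[X]) ^ (l + 1) = (1 - X) ^ l - X * (1 - X) ^ l := by ring
    rw [hq]
    generalize (1 - X : ℤ[X]) ^ l = q at *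
    simp only [Polynomial.coeff_sub, sub_mul, Finset.sum_sub_distrib]
    rw [Finset.sum_range_succ' (fun k => (X * q : ℤ[X]).coeff k * (((l + 1 - k).choose r : ℕ) : ℤ))]
    rw [Finset.sum_range_succ _ (l + 1), hdeg]
    simp only [Polynomial.coeff_X_mul, Polynomial.coeff_X_mul_zero, zero_mul, add_zero]
    rw [← Finset.sum_sub_distrib]
    cases r with
    | zero => simp
    | succ r =>
      have := ih r
      simp only [add_left_inj]
      rw [← this]
      apply Finset.sum_congr rfl
      intro k hk
      rw [Finset.mem_range] at hk
      have e1 : l + 1 - k = (l - k) + 1 := by omega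
      have e2 : l + 1 - (k + 1) = l - k := by omega
      rw [e1, e2, Nat.choose_succ_succ]
      push_cast
      ring

lemma aux_h2 (n i j : ℕ) (hi : i ≤ n) (hj : j ≤ n) :
    ∑ k ∈ Finset.range (n + 1), (X ^ j * (1 - X : ℤ[X]) ^ (n - j)).coeff k
      * ((n - k).choose (n - i) : ℤ) = if j = i then 1 else 0 := by
  obtain ⟨l, rfl⟩ := Nat.exists_eq_add_of_le hj
  have e : j + l - j = l := by omega
  rw [e, add_assoc, Finset.sum_range_add]
  rw [Finset.sum_eq_zero, zero_add]
  · have := aux_h1 l (j + l - i)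
    have h2 : (j + l - i = l) ↔ (j = i) := by omega
    simp only [h2] at this
    rw [← this]
    apply Finset.sum_congr rfl
    intro k hk
    have e3 : j + l - (j + k) = l - k := by omega
    rw [e3, add_comm j k, Polynomial.coeff_X_pow_mul]
  · intro k hk
    rw [Finset.mem_range] at hk
    rw [Polynomial.coeff_X_pow_mul']
    simp [hk]

lemma aux_h (P : Type*) [Fintype P] [PartialOrder P] (ρ : P → ℕ) (n i : ℕ) (hi : i ≤ n) :
    ∑ k ∈ Finset.range (n + 1), (hpolyP P ρ n).coeff k * ((n - k).choose (n - i) : ℤ)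
      = ((Finset.univ.filter (fun y : P => ρ y = i)).card : ℤ) := by
  unfold hpolyP
  simp only [Polynomial.finsetSum_coeff, Finset.sum_mul, mul_assoc, Polynomial.coeff_C_mul]
  rw [Finset.sum_comm]
  simp only [← Finset.mul_sum]
  rw [Finset.sum_eq_single i]
  · simp only [aux_h2 n i i hi hi]; simp
  · intro j hj hji
    rw [Finset.mem_range] at hj
    rw [aux_h2 n i j hi (by omega)]
    simp [hji]
  · intro h; simp at h; omega

/-- The multinomial coefficient attached to a set of ranks. -/
def auxMul (T : Finset ℕ) : ℕ := ∏ t ∈ T, t.choose ((T.filter (· < t)).sup id)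

lemma auxMul_insert (T : Finset ℕ) (m : ℕ) (h : ∀ t ∈ T, t < m) :
    auxMul (insert m T) = m.choose (T.sup id) * auxMul T := by
  unfold auxMul
  have hm : m ∉ T := fun hh => lt_irrefl _ (h m hh)
  rw [Finset.prod_insert hm]
  congr 1
  · congr 2
    ext x
    simp only [Finset.mem_filter, Finset.mem_insert]
    constructor
    · rintro ⟨rfl | hx, h2⟩
      · omega
      · exact hx
    · intro hx; exact ⟨Or.inr hx, h x hx⟩
  · apply Finset.prod_congr rfl
    intro t ht
    congr 2
    ext x
    simp only [Finset.mem_filter, Finset.mem_insert]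
    have := h t ht
    constructor
    · rintro ⟨rfl | hx, h2⟩
      · omega
      · exact ⟨hx, h2⟩
    · rintro ⟨hx, h2⟩; exact ⟨Or.inr hx, h2⟩

/-- Insert the last value `k` into a permutation. -/
def auxSnoc {n : ℕ} (k : Fin (n + 1)) (u : Equiv.Perm (Fin n)) : Equiv.Perm (Fin (n + 1)) :=
  ((finSuccEquiv' (Fin.last n)).trans (Equiv.optionCongr u)).trans (finSuccEquiv' k).symm

lemma auxSnoc_last {n : ℕ} (k : Fin (n + 1)) (u : Equiv.Perm (Fin n)) :
    auxSnoc k u (Fin.last n) = k := by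
  simp [auxSnoc]

lemma auxSnoc_castSucc {n : ℕ} (k : Fin (n + 1)) (u : Equiv.Perm (Fin n)) (i : Fin n) :
    auxSnoc k u i.castSucc = k.succAbove (u i) := by
  have : finSuccEquiv' (Fin.last n) i.castSucc = some i := by
    rw [← Fin.succAbove_last_apply, finSuccEquiv'_succAbove]
  simp [auxSnoc, this]

lemma auxSnoc_inj {n : ℕ} (k : Fin (n + 1)) : Function.Injective (auxSnoc (n := n) k) := by
  intro u v h
  ext i
  have := congrArg (fun w => w i.castSucc) h
  simp only [auxSnoc_castSucc] at this
  rw [Fin.succAbove_right_injective this]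

lemma auxSnoc_surj {n : ℕ} (w : Equiv.Perm (Fin (n + 1))) :
    ∃ u, auxSnoc (w (Fin.last n)) u = w := by
  have hb : ∀ i : Fin n, ∃ j : Fin n, (w (Fin.last n)).succAbove j = w i.castSucc := by
    intro i
    apply Fin.exists_succAbove_eq
    intro h
    exact (Fin.castSucc_lt_last i).ne (w.injective h)
  choose f hf using hb
  have hinj : Function.Injective f := by
    intro a b hab
    have : w a.castSucc = w b.castSucc := by rw [← hf, ← hf, hab]
    exact Fin.castSucc_injective _ (w.injective this)
  refine ⟨Equiv.ofBijective f (Finite.injective_iff_bijective.mp hinj), ?_⟩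
  ext i
  congr 1
  induction i using Fin.lastCases with
  | last => rw [auxSnoc_last]
  | cast i => rw [auxSnoc_castSucc, Equiv.ofBijective_apply, hf]

lemma mem_descSet {n : ℕ} (w : Equiv.Perm (Fin (n + 1))) (i : ℕ) :
    i ∈ descSet w ↔ ∃ j : Fin n, (j : ℕ) + 1 = i ∧ w j.succ < w j.castSucc := by
  unfold descSet
  simp only [Finset.mem_image, Finset.mem_filter, Finset.mem_univ, true_and]
  constructor
  · rintro ⟨j, h1, h2⟩
    exact ⟨j, h2, h1⟩
  · rintro ⟨j, h1, h2⟩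
    exact ⟨j, h2, h1⟩

lemma aux_desc_snoc {n : ℕ} (k : Fin (n + 2)) (u : Equiv.Perm (Fin (n + 1))) (T : Finset ℕ) :
    Finset.Icc 1 (n + 1) \ descSet (auxSnoc k u) ⊆ T ↔
      (Finset.Icc 1 n \ descSet u ⊆ T) ∧ (n + 1 ∈ T ∨ (k : ℕ) ≤ (u (Fin.last n) : ℕ)) := by
  have h1 : ∀ j : Fin n, ((j : ℕ) + 1 ∈ descSet (auxSnoc k u) ↔ (j : ℕ) + 1 ∈ descSet u) := by
    intro j
    rw [mem_descSet, mem_descSet]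
    constructor
    · rintro ⟨j', h, h'⟩
      have : j' = j.castSucc := by ext; simp; omega
      subst this
      rw [Fin.succ_castSucc, auxSnoc_castSucc, auxSnoc_castSucc, Fin.succAbove_lt_succAbove_iff] at h'
      exact ⟨j, rfl, h'⟩
    · rintro ⟨j', h, h'⟩
      have : j' = j := by ext; omega
      subst this
      refine ⟨j'.castSucc, rfl, ?_⟩
      rw [Fin.succ_castSucc, auxSnoc_castSucc, auxSnoc_castSucc, Fin.succAbove_lt_succAbove_iff]
      exact h'
  have h2 : n + 1 ∈ descSet (auxSnoc k u) ↔ (k : ℕ) ≤ (u (Fin.last n) : ℕ) := by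
    have : n + 1 ∈ descSet (auxSnoc k u) ↔ k < k.succAbove (u (Fin.last n)) := by
      rw [mem_descSet, ← auxSnoc_castSucc]
      constructor
      · rintro ⟨j', h, h'⟩
        have : j' = Fin.last n := by ext; simp; omega
        subst this
        rwa [Fin.succ_last, auxSnoc_last] at h'
      · intro h
        refine ⟨Fin.last n, rfl, ?_⟩
        rwa [Fin.succ_last, auxSnoc_last]
    rw [this, Fin.lt_succAbove_iff_le_castSucc, Fin.le_def]
    simp
  simp only [Finset.subset_iff, Finset.mem_sdiff, Finset.mem_Icc]
  constructor
  · intro h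
    refine ⟨?_, ?_⟩
    · rintro x ⟨⟨hx1, hx2⟩, hx3⟩
      obtain ⟨j, rfl⟩ := Nat.exists_eq_add_of_le' hx1
      apply h
      refine ⟨by omega, ?_⟩
      rwa [h1 ⟨j, by omega⟩]
    · rw [← h2]
      by_contra! hc
      exact hc.1 (h ⟨by omega, hc.2⟩)
  · rintro ⟨h, h'⟩ x ⟨⟨hx1, hx2⟩, hx3⟩
    by_cases hx : x = n + 1
    · subst hx
      rw [h2] at hx3
      tauto
    · obtain ⟨j, rfl⟩ := Nat.exists_eq_add_of_le' hx1
      apply h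
      refine ⟨by omega, ?_⟩
      rwa [h1 ⟨j, by omega⟩] at hx3

/-- Number of permutations with last value `k` and ascent set inside `T`. -/
def auxGam (n k : ℕ) (T : Finset ℕ) : ℕ :=
  (Finset.univ.filter (fun w : Equiv.Perm (Fin (n + 1)) =>
    (w (Fin.last n) : ℕ) = k ∧ Finset.Icc 1 n \ descSet w ⊆ T)).card

lemma auxGam_succ (n k : ℕ) (hk : k ≤ n + 1) (T : Finset ℕ) :
    auxGam (n + 1) k T =
      ∑ j ∈ Finset.range (n + 1), if (n + 1 ∈ T ∨ k ≤ j) then auxGam n j T else 0 := by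
  have e1 : auxGam (n + 1) k T = (Finset.univ.filter (fun u : Equiv.Perm (Fin (n + 1)) =>
      (Finset.Icc 1 n \ descSet u ⊆ T) ∧ (n + 1 ∈ T ∨ k ≤ (u (Fin.last n) : ℕ)))).card := by
    unfold auxGam
    symm
    apply Finset.card_bij (fun u _ => auxSnoc (⟨k, by omega⟩ : Fin (n + 2)) u)
    · intro u hu
      simp only [Finset.mem_filter, Finset.mem_univ, true_and] at hu ⊢
      rw [auxSnoc_last, aux_desc_snoc]
      exact ⟨rfl, hu⟩
    · intro u _ v _ h
      exact auxSnoc_inj _ h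
    · intro w hw
      simp only [Finset.mem_filter, Finset.mem_univ, true_and] at hw
      obtain ⟨u, hu⟩ := auxSnoc_surj w
      have hk' : w (Fin.last (n + 1)) = ⟨k, by omega⟩ := by ext; exact hw.1
      rw [hk'] at hu
      refine ⟨u, ?_, hu⟩
      have := hw.2
      rw [← hu, aux_desc_snoc] at this
      simpa using this
  rw [e1, Finset.card_eq_sum_card_fiberwise (f := fun u => (u (Fin.last n) : ℕ))
    (t := Finset.range (n + 1))]
  · apply Finset.sum_congr rfl
    intro j hj
    unfold auxGam
    split_ifs with h
    · congr 1
      ext u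
      simp only [Finset.mem_filter, Finset.mem_univ, true_and]
      constructor
      · rintro ⟨⟨a, b⟩, c⟩; exact ⟨c, a⟩
      · rintro ⟨c, a⟩; exact ⟨⟨a, c ▸ h⟩, c⟩
    · rw [Finset.card_eq_zero, Finset.filter_eq_empty_iff]
      intro u hu hc
      simp only [Finset.mem_filter, Finset.mem_univ, true_and] at hu
      exact h (hc ▸ hu.2)
  · intro u _
    simp only [Finset.coe_range, Set.mem_Iio]
    exact (u (Fin.last n)).isLt

lemma aux_hockey (N r : ℕ) : ∑ i ∈ Finset.range N, i.choose r = N.choose (r + 1) := by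
  induction N with
  | zero => simp
  | succ N ih => rw [Finset.sum_range_succ, ih, Nat.choose_succ_succ, add_comm]

lemma aux_hockey2 (n k r : ℕ) (hk : k ≤ n + 1) :
    ∑ j ∈ Finset.range (n + 1), (if k ≤ j then (n - j).choose r else 0)
      = (n + 1 - k).choose (r + 1) := by
  rw [← aux_hockey, ← Finset.sum_filter]
  apply Finset.sum_nbij' (fun j => n - j) (fun j => n - j)
  all_goals simp
  all_goals intros
  all_goals omega

lemma auxGam_eq (n : ℕ) : ∀ (k : ℕ) (_ : k ≤ n) (T : Finset ℕ),
    auxGam n k T = (n - k).choose (n - (T ∩ Finset.Icc 1 n).sup id) *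
      auxMul (T ∩ Finset.Icc 1 n) := by
  induction n with
  | zero =>
    intro k hk T
    have : k = 0 := by omega
    subst this
    simp [auxGam, auxMul]
  | succ n ih =>
    intro k hk T
    rw [auxGam_succ n k hk]
    have hsup : (T ∩ Finset.Icc 1 n).sup id ≤ n := by
      apply Finset.sup_le
      intro b hb
      simp at hb
      simp; omega
    by_cases hT : n + 1 ∈ T
    · have e : T ∩ Finset.Icc 1 (n + 1) = insert (n + 1) (T ∩ Finset.Icc 1 n) := by
        ext x
        simp only [Finset.mem_inter, Finset.mem_Icc, Finset.mem_insert]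
        constructor
        · rintro ⟨a, b⟩
          by_cases hx : x = n + 1
          · exact Or.inl hx
          · exact Or.inr ⟨a, by omega⟩
        · rintro (rfl | ⟨a, b⟩)
          · exact ⟨hT, by omega⟩
          · exact ⟨a, by omega⟩
      rw [e, auxMul_insert _ _ (by intro t ht; simp at ht; omega)]
      rw [Finset.sup_insert, id, sup_eq_left.mpr (by omega)]
      simp only [hT, true_or, if_true, Nat.sub_self, Nat.choose_zero_right, one_mul]
      have h0 := aux_hockey2 n 0 (n - (T ∩ Finset.Icc 1 n).sup id) (by omega)
      simp only [Nat.zero_le, if_true] at h0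
      have e2 : n - (T ∩ Finset.Icc 1 n).sup id + 1 = n + 1 - (T ∩ Finset.Icc 1 n).sup id := by
        omega
      rw [e2, Nat.sub_zero, Nat.choose_symm (by omega)] at h0
      rw [← h0, Finset.sum_mul]
      apply Finset.sum_congr rfl
      intro j hj
      rw [Finset.mem_range] at hj
      exact ih j (by omega) T
    · have e : T ∩ Finset.Icc 1 (n + 1) = T ∩ Finset.Icc 1 n := by
        ext x
        simp only [Finset.mem_inter, Finset.mem_Icc]
        constructor
        · rintro ⟨a, b⟩
          have : x ≠ n + 1 := by rintro rfl; exact hT a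
          exact ⟨a, by omega⟩
        · rintro ⟨a, b⟩
          exact ⟨a, by omega⟩
      rw [e]
      have h0 := aux_hockey2 n k (n - (T ∩ Finset.Icc 1 n).sup id) (by omega)
      have e2 : n - (T ∩ Finset.Icc 1 n).sup id + 1 = n + 1 - (T ∩ Finset.Icc 1 n).sup id := by
        omega
      rw [e2] at h0
      rw [← h0, Finset.sum_mul]
      apply Finset.sum_congr rfl
      intro j hj
      rw [Finset.mem_range] at hj
      simp only [hT, false_or]
      split_ifs
      · exact ih j (by omega) T
      · simp

section AuxPoset

variable {P : Type*} [Fintype P] [PartialOrder P] [OrderBot P] {ρ : P → ℕ}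

lemma aux_rank (hsimp : ∀ y : P, Nonempty ((Set.Icc (⊥ : P) y) ≃o Finset (Fin (ρ y))))
    (y : P) (e : (Set.Icc (⊥ : P) y) ≃o Finset (Fin (ρ y))) (z : Set.Icc (⊥ : P) y) :
    (e z).card = ρ z := by
  obtain ⟨e'⟩ := hsimp z
  have h1 : Nat.card (Set.Icc (⊥ : P) (z : P)) = 2 ^ ρ z := by
    rw [Nat.card_congr e'.toEquiv]
    simp
  let g : Set.Icc (⊥ : P) (z : P) ≃ (e z).powerset :=
    { toFun := fun x => ⟨e ⟨x, bot_le, x.2.2.trans z.2.2⟩, by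
        rw [Finset.mem_powerset]
        apply e.monotone
        exact x.2.2⟩
      invFun := fun A => ⟨e.symm A.1, bot_le, by
        have h := Finset.mem_powerset.mp A.2
        have h2 : e.symm A.1 ≤ z := by
          rw [e.symm_apply_le]; exact h
        exact h2⟩
      left_inv := by intro x; simp
      right_inv := by
        intro A
        apply Subtype.ext
        exact e.apply_symm_apply A.1 }
  have h2 : Nat.card (Set.Icc (⊥ : P) (z : P)) = 2 ^ (e z).card := by
    rw [Nat.card_congr g, Nat.card_eq_fintype_card, Fintype.card_coe, Finset.card_powerset]
  rw [h1] at h2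
  exact (Nat.pow_right_injective le_rfl h2).symm

lemma aux_strict (hsimp : ∀ y : P, Nonempty ((Set.Icc (⊥ : P) y) ≃o Finset (Fin (ρ y))))
    {x y : P} (h : x < y) : ρ x < ρ y := by
  obtain ⟨e⟩ := hsimp y
  have h1 := aux_rank hsimp y e ⟨x, bot_le, h.le⟩
  have h2 := aux_rank hsimp y e ⟨y, bot_le, le_rfl⟩
  have h3 : (⟨x, bot_le, h.le⟩ : Set.Icc (⊥ : P) y) < ⟨y, bot_le, le_rfl⟩ := h
  have h4 := Finset.card_lt_card (e.strictMono h3)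
  exact (h1.symm.trans_lt h4).trans_eq h2

lemma aux_between (hsimp : ∀ y : P, Nonempty ((Set.Icc (⊥ : P) y) ≃o Finset (Fin (ρ y))))
    {x z : P} (h : x ≤ z) {t : ℕ} (h1 : ρ x ≤ t) (h2 : t ≤ ρ z) :
    ∃ y, x ≤ y ∧ y ≤ z ∧ ρ y = t := by
  obtain ⟨e⟩ := hsimp z
  have h3 := aux_rank hsimp z e ⟨x, bot_le, h⟩
  have h4 := aux_rank hsimp z e ⟨z, bot_le, le_rfl⟩
  have hxz : e ⟨x, bot_le, h⟩ ⊆ e ⟨z, bot_le, le_rfl⟩ := e.monotone h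
  obtain ⟨A, hA1, hA2, hA3⟩ := Finset.exists_subsuperset_card_eq hxz
    (h3.trans_le h1) (h2.trans_eq h4.symm)
  refine ⟨(e.symm A).1, ?_, (e.symm A).2.2, ?_⟩
  · have : (⟨x, bot_le, h⟩ : Set.Icc (⊥ : P) z) ≤ e.symm A := by
      rw [e.le_symm_apply]; exact hA1
    exact this
  · rw [← aux_rank hsimp z e, e.apply_symm_apply, hA3]

lemma aux_count (hsimp : ∀ y : P, Nonempty ((Set.Icc (⊥ : P) y) ≃o Finset (Fin (ρ y))))
    (y : P) (m : ℕ) (hm : m < ρ y) :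
    (Finset.univ.filter (fun z : P => z < y ∧ ρ z = m)).card = (ρ y).choose m := by
  obtain ⟨e⟩ := hsimp y
  have : (Finset.powersetCard m (Finset.univ : Finset (Fin (ρ y)))).card = (ρ y).choose m := by
    simp
  rw [← this]
  symm
  apply Finset.card_bij (fun A _ => ((e.symm A).1 : P))
  · intro A hA
    rw [Finset.mem_powersetCard] at hA
    have hr : ρ (e.symm A).1 = m := by
      rw [← aux_rank hsimp y e, e.apply_symm_apply, hA.2]
    simp only [Finset.mem_filter, Finset.mem_univ, true_and]
    refine ⟨lt_of_le_of_ne (e.symm A).2.2 ?_, hr⟩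
    intro h
    rw [h] at hr
    omega
  · intro A _ B _ h
    exact e.symm.injective (Subtype.ext h)
  · intro z hz
    simp only [Finset.mem_filter, Finset.mem_univ, true_and] at hz
    refine ⟨e ⟨z, bot_le, hz.1.le⟩, ?_, by simp⟩
    rw [Finset.mem_powersetCard, aux_rank hsimp y e]
    exact ⟨Finset.subset_univ _, hz.2⟩

/-- The chains with rank set `T` whose elements satisfy `Q`. -/
def auxChains (ρ : P → ℕ) (Q : P → Prop) (T : Finset ℕ) : Finset (Finset P) :=
  Finset.univ.filter (fun F => IsChain (· ≤ ·) (F : Set P) ∧ F.image ρ = T ∧ ∀ x ∈ F, Q x)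

lemma aux_chain_inj (hsimp : ∀ y : P, Nonempty ((Set.Icc (⊥ : P) y) ≃o Finset (Fin (ρ y))))
    {F : Set P} (hF : IsChain (· ≤ ·) F) {x y : P} (hx : x ∈ F) (hy : y ∈ F) (h : ρ x ≤ ρ y) :
    x ≤ y := by
  rcases hF.total hx hy with h1 | h1
  · exact h1
  · rcases h1.eq_or_lt with h2 | h2
    · exact h2.ge
    · have := aux_strict hsimp h2
      omega

lemma aux_chains_insert
    (hsimp : ∀ y : P, Nonempty ((Set.Icc (⊥ : P) y) ≃o Finset (Fin (ρ y))))
    (Q : P → Prop) (hQ : ∀ x y, x < y → Q y → Q x) (T : Finset ℕ) (m : ℕ) (h : ∀ t ∈ T, t < m) :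
    (auxChains ρ Q (insert m T)).card =
      ∑ y ∈ Finset.univ.filter (fun y : P => Q y ∧ ρ y = m), (auxChains ρ (· < y) T).card := by
  rw [← Finset.card_sigma]
  symm
  apply Finset.card_bij (fun p _ => insert p.1 p.2)
  · rintro ⟨y, F⟩ hp
    simp only [Finset.mem_sigma, Finset.mem_filter, Finset.mem_univ, true_and, auxChains] at hp ⊢
    obtain ⟨⟨hy, hm⟩, hF, hT, hlt⟩ := hp
    refine ⟨?_, ?_, ?_⟩
    · rw [Finset.coe_insert]
      apply hF.insert
      intro b hb _
      exact Or.inr (hlt b hb).le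
    · rw [Finset.image_insert, hT, hm]
    · intro x hx
      rcases Finset.mem_insert.mp hx with rfl | hx
      · exact hy
      · exact hQ x y (hlt x hx) hy
  · rintro ⟨y, F⟩ hp ⟨y', F'⟩ hp' heq
    simp only [Finset.mem_sigma, Finset.mem_filter, Finset.mem_univ, true_and, auxChains] at hp hp' heq
    obtain ⟨⟨hy, hm⟩, hF, hT, hlt⟩ := hp
    obtain ⟨⟨hy', hm'⟩, hF', hT', hlt'⟩ := hp'
    have hyy : y = y' := by
      have : y ∈ insert y' F' := heq ▸ Finset.mem_insert_self _ _
      rcases Finset.mem_insert.mp this with h1 | h1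
      · exact h1
      · have := aux_strict hsimp (hlt' y h1)
        omega
    subst hyy
    have hFF : F = F' := by
      have h1 : y ∉ F := fun hh => lt_irrefl _ (hlt y hh)
      have h2 : y ∉ F' := fun hh => lt_irrefl _ (hlt' y hh)
      rw [← Finset.erase_insert h1, heq, Finset.erase_insert h2]
    subst hFF
    rfl
  · intro G hG
    simp only [Finset.mem_filter, Finset.mem_univ, true_and, auxChains] at hG
    obtain ⟨hG, hT, hq⟩ := hG
    have : m ∈ G.image ρ := by rw [hT]; exact Finset.mem_insert_self _ _
    obtain ⟨y, hy, hym⟩ := Finset.mem_image.mp this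
    have hle : ∀ x ∈ G.erase y, x < y := by
      intro x hx
      have hx' := Finset.mem_of_mem_erase hx
      refine lt_of_le_of_ne ?_ (Finset.ne_of_mem_erase hx)
      apply aux_chain_inj hsimp hG hx' hy
      have : ρ x ∈ G.image ρ := Finset.mem_image_of_mem _ hx'
      rw [hT] at this
      rcases Finset.mem_insert.mp this with h1 | h1
      · omega
      · have := h _ h1
        omega
    refine ⟨⟨y, G.erase y⟩, ?_, Finset.insert_erase hy⟩
    simp only [Finset.mem_sigma, Finset.mem_filter, Finset.mem_univ, true_and, auxChains]
    refine ⟨⟨hq y hy, hym⟩, hG.mono (by simp), ?_, hle⟩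
    ext t
    constructor
    · intro ht
      obtain ⟨x, hx, rfl⟩ := Finset.mem_image.mp ht
      have h1 : ρ x ∈ G.image ρ := Finset.mem_image_of_mem _ (Finset.mem_of_mem_erase hx)
      rw [hT] at h1
      have := aux_strict hsimp (hle x hx)
      rcases Finset.mem_insert.mp h1 with h1 | h1
      · omega
      · exact h1
    · intro ht
      have h1 : t ∈ G.image ρ := by rw [hT]; exact Finset.mem_insert_of_mem ht
      obtain ⟨x, hx, rfl⟩ := Finset.mem_image.mp h1
      apply Finset.mem_image_of_mem
      apply Finset.mem_erase_of_ne_of_mem _ hx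
      rintro rfl
      have := h _ ht
      omega

lemma aux_chains_empty (Q : P → Prop) : (auxChains ρ Q ∅).card = 1 := by
  rw [Finset.card_eq_one]
  refine ⟨∅, ?_⟩
  ext F
  simp only [auxChains, Finset.mem_filter, Finset.mem_univ, true_and, Finset.image_eq_empty,
    Finset.mem_singleton]
  constructor
  · exact fun h => h.2.1
  · rintro rfl
    simp

lemma aux_chains_lt (hsimp : ∀ y : P, Nonempty ((Set.Icc (⊥ : P) y) ≃o Finset (Fin (ρ y))))
    (T : Finset ℕ) : ∀ y : P, (∀ t ∈ T, t < ρ y) →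
    (auxChains ρ (· < y) T).card = (ρ y).choose (T.sup id) * auxMul T := by
  induction T using Finset.induction_on_max with
  | empty => intro y _; rw [aux_chains_empty]; simp [auxMul]
  | insert m T hT ih =>
    intro y hy
    rw [aux_chains_insert hsimp _ (fun a b hab hb => hab.trans hb) T m hT, auxMul_insert T m hT,
      Finset.sup_insert]
    have hs : T.sup id ≤ m := Finset.sup_le (fun t ht => (hT t ht).le)
    rw [id_eq, sup_eq_left.mpr hs, ← aux_count hsimp y m (hy m (Finset.mem_insert_self _ _))]
    rw [Finset.sum_congr rfl (g := fun _ => m.choose (T.sup id) * auxMul T)]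
    · simp
    · intro z hz
      simp only [Finset.mem_filter, Finset.mem_univ, true_and] at hz
      rw [ih z (by rw [hz.2]; exact hT), hz.2]

lemma aux_chains_all (hsimp : ∀ y : P, Nonempty ((Set.Icc (⊥ : P) y) ≃o Finset (Fin (ρ y))))
    (hbot : ρ ⊥ = 0) (T : Finset ℕ) :
    (auxChains ρ (fun _ => True) T).card =
      (Finset.univ.filter (fun y : P => ρ y = T.sup id)).card * auxMul T := by
  induction T using Finset.induction_on_max with
  | empty =>
    rw [aux_chains_empty]
    have : (Finset.univ.filter (fun y : P => ρ y = (∅ : Finset ℕ).sup id)) = {⊥} := by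
      ext y
      simp only [Finset.mem_filter, Finset.mem_univ, true_and, Finset.sup_empty,
        Finset.mem_singleton]
      constructor
      · intro h
        by_contra hne
        have := aux_strict hsimp (bot_lt_iff_ne_bot.mpr hne)
        simp at h
        omega
      · rintro rfl
        exact hbot
    rw [this]
    simp [auxMul]
  | insert m T hT ih =>
    rw [aux_chains_insert hsimp _ (fun a b hab hb => trivial) T m hT, auxMul_insert T m hT,
      Finset.sup_insert]
    have hs : T.sup id ≤ m := Finset.sup_le (fun t ht => (hT t ht).le)
    rw [id_eq, sup_eq_left.mpr hs]
    rw [Finset.sum_congr rfl (g := fun _ => m.choose (T.sup id) * auxMul T)]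
    · simp
    · intro z hz
      simp only [Finset.mem_filter, Finset.mem_univ, true_and] at hz
      rw [aux_chains_lt hsimp T z (by rw [hz]; exact hT), hz]

/-- The maximal chain of the rank-selected poset attached to a chain of `P`. -/
def auxPhi (ρ : P → ℕ) (T : Finset ℕ) (F : Finset P) : Set ↥(rankSel P ρ T) :=
  {z | z.1 = ⊤ ∨ z.1 = ((⊥ : P) : WithTop P) ∨ ∃ y ∈ F, z.1 = (y : WithTop P)}

lemma aux_alpha (n : ℕ) (hbot : ρ ⊥ = 0) (hmax : ∀ x : P, IsMax x → ρ x = n)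
    (hsimp : ∀ y : P, Nonempty ((Set.Icc (⊥ : P) y) ≃o Finset (Fin (ρ y))))
    (T : Finset ℕ) (hT : T ⊆ Finset.Icc 1 n) :
    alphaP P ρ T = (auxChains ρ (fun _ => True) T).card := by
  have hT1 : ∀ t ∈ T, 1 ≤ t ∧ t ≤ n := fun t ht => Finset.mem_Icc.mp (hT ht)
  have himg : {C : Set ↥(rankSel P ρ T) | IsMaxChain (· ≤ ·) C} =
      auxPhi ρ T '' (auxChains ρ (fun _ => True) T : Set (Finset P)) := by
    ext C
    simp only [Set.mem_ofPred_eq, Set.mem_image, Finset.mem_coe, auxChains, Finset.mem_filter,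
      Finset.mem_univ, true_and]
    constructor
    · intro hC
      have hmem : ∀ z : ↥(rankSel P ρ T), (∀ c ∈ C, c ≤ z ∨ z ≤ c) → z ∈ C := by
        intro z hz
        have h1 : IsChain (· ≤ ·) (insert z C) := hC.1.insert (fun b hb _ => (hz b hb).symm)
        have h2 := hC.2 h1 (Set.subset_insert z C)
        rw [h2]
        exact Set.mem_insert z C
      have htop : (⟨⊤, Or.inl rfl⟩ : ↥(rankSel P ρ T)) ∈ C :=
        hmem _ (fun c _ => Or.inl (show c.1 ≤ ⊤ from le_top))
      have hbotle : ∀ c : WithTop P, ((⊥ : P) : WithTop P) ≤ c := by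
        intro c
        induction c using WithTop.recTopCoe with
        | top => exact le_top
        | coe a => exact WithTop.coe_le_coe.mpr bot_le
      have hbotm : (⟨((⊥ : P) : WithTop P), Or.inr (Or.inl rfl)⟩ : ↥(rankSel P ρ T)) ∈ C :=
        hmem _ (fun c _ => Or.inr (hbotle c.1))
      -- the chain as a subset of P
      let D : Finset P := Finset.univ.filter (fun y => ∃ z ∈ C, z.1 = (y : WithTop P))
      have hD : ∀ y, y ∈ D ↔ ∃ z ∈ C, z.1 = (y : WithTop P) := by
        intro y; simp [D]
      have hDc : IsChain (· ≤ ·) (D : Set P) := by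
        intro x hx y hy _
        rw [Finset.mem_coe, hD] at hx hy
        obtain ⟨z, hz, hzx⟩ := hx
        obtain ⟨w, hw, hwy⟩ := hy
        rcases hC.1.total hz hw with h | h
        · left
          have h' : z.1 ≤ w.1 := h
          rw [hzx, hwy] at h'
          exact WithTop.coe_le_coe.mp h'
        · right
          have h' : w.1 ≤ z.1 := h
          rw [hzx, hwy] at h'
          exact WithTop.coe_le_coe.mp h'
      have hbD : ⊥ ∈ D := (hD _).mpr ⟨_, hbotm, rfl⟩
      have hDm : ∀ y, ρ y ∈ T → (∀ x ∈ D, x ≤ y ∨ y ≤ x) → y ∈ D := by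
        intro y hy hcomp
        rw [hD]
        refine ⟨⟨(y : WithTop P), Or.inr (Or.inr ⟨y, rfl, hy⟩)⟩, ?_, rfl⟩
        apply hmem
        rintro ⟨c, hc⟩ hcC
        induction c using WithTop.recTopCoe with
        | top => right; exact (le_top : (y : WithTop P) ≤ ⊤)
        | coe a =>
          have ha : a ∈ D := (hD a).mpr ⟨_, hcC, rfl⟩
          rcases hcomp a ha with h | h
          · left; exact WithTop.coe_le_coe.mpr h
          · right; exact WithTop.coe_le_coe.mpr h
      have hranks : ∀ t ∈ T, ∃ y ∈ D, ρ y = t := by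
        intro t ht
        by_contra! hno
        -- largest element of rank below t
        obtain ⟨x, hx, hxm⟩ := Finset.exists_max_image (D.filter (fun x => ρ x < t)) ρ
          ⟨⊥, by rw [Finset.mem_filter]; exact ⟨hbD, by have := hT1 t ht; omega⟩⟩
        rw [Finset.mem_filter] at hx
        have key : ∀ z, x ≤ z → t ≤ ρ z → (∀ a ∈ D, t < ρ a → z ≤ a) → False := by
          intro z hxz htz hza
          obtain ⟨y, hxy, hyz, hyt⟩ := aux_between hsimp hxz hx.2.le htz
          apply hno y _ hyt
          apply hDm y (hyt ▸ ht)
          intro a ha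
          rcases lt_trichotomy (ρ a) t with h | h | h
          · left
            have h1 := hxm a (Finset.mem_filter.mpr ⟨ha, h⟩)
            exact (aux_chain_inj hsimp hDc ha hx.1 h1).trans hxy
          · exact absurd h (hno a ha)
          · right
            exact hyz.trans (hza a ha h)
        by_cases hne : (D.filter (fun x => t < ρ x)).Nonempty
        · obtain ⟨z, hz, hzm⟩ := Finset.exists_min_image _ ρ hne
          rw [Finset.mem_filter] at hz
          apply key z (aux_chain_inj hsimp hDc hx.1 hz.1 (by omega)) hz.2.le
          intro a ha hta
          exact aux_chain_inj hsimp hDc hz.1 ha (hzm a (Finset.mem_filter.mpr ⟨ha, hta⟩))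
        · obtain ⟨z, hxz, hz⟩ := Finite.exists_le_maximal (p := fun _ : P => True) (a := x) trivial
          have hzmax : IsMax z := fun b hb => hz.2 trivial hb
          apply key z hxz (by rw [hmax z hzmax]; exact (hT1 t ht).2)
          intro a ha hta
          exact absurd ⟨a, Finset.mem_filter.mpr ⟨ha, hta⟩⟩ hne
      refine ⟨D.filter (fun y => ρ y ∈ T), ⟨?_, ?_, fun _ _ => trivial⟩, ?_⟩
      · exact hDc.mono (by intro a ha; exact (Finset.mem_filter.mp ha).1)
      · ext t
        simp only [Finset.mem_image, Finset.mem_filter]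
        constructor
        · rintro ⟨y, ⟨_, h⟩, rfl⟩; exact h
        · intro ht
          obtain ⟨y, hy, rfl⟩ := hranks t ht
          exact ⟨y, ⟨hy, ht⟩, rfl⟩
      · ext z
        simp only [auxPhi, Set.mem_ofPred_eq]
        constructor
        · rintro (h | h | ⟨y, hy, h⟩)
          · have : z = ⟨⊤, Or.inl rfl⟩ := Subtype.ext h
            rw [this]; exact htop
          · have : z = ⟨((⊥ : P) : WithTop P), Or.inr (Or.inl rfl)⟩ := Subtype.ext h
            rw [this]; exact hbotm
          · obtain ⟨w, hw, hwy⟩ := (hD y).mp (Finset.mem_filter.mp hy).1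
            have : z = w := Subtype.ext (h.trans hwy.symm)
            rw [this]; exact hw
        · intro hz
          rcases z.2 with h | h | ⟨y, h, hy⟩
          · exact Or.inl h
          · exact Or.inr (Or.inl h)
          · exact Or.inr (Or.inr ⟨y, Finset.mem_filter.mpr ⟨(hD y).mpr ⟨z, hz, h⟩, hy⟩, h⟩)
    · rintro ⟨F, ⟨hF, hFT, -⟩, rfl⟩
      have hbotle : ∀ c : WithTop P, ((⊥ : P) : WithTop P) ≤ c := by
        intro c
        induction c using WithTop.recTopCoe with
        | top => exact le_top
        | coe a => exact WithTop.coe_le_coe.mpr bot_le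
      refine ⟨?_, ?_⟩
      · intro a ha b hb _
        change a.1 ≤ b.1 ∨ b.1 ≤ a.1
        rcases ha with h | h | ⟨x, hx, h⟩
        · right; rw [h]; exact le_top
        · left; rw [h]; exact hbotle _
        · rcases hb with h' | h' | ⟨y, hy, h'⟩
          · left; rw [h']; exact le_top
          · right; rw [h']; exact hbotle _
          · rw [h, h', WithTop.coe_le_coe, WithTop.coe_le_coe]
            exact hF.total hx hy
      · intro C hC hsub
        apply Set.Subset.antisymm hsub
        intro z hz
        rcases z.2 with h | h | ⟨y, h, hy⟩
        · exact Or.inl h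
        · exact Or.inr (Or.inl h)
        · right; right
          rw [← hFT] at hy
          obtain ⟨x, hx, hxy⟩ := Finset.mem_image.mp hy
          have hxT : ρ x ∈ T := by rw [← hFT]; exact Finset.mem_image_of_mem _ hx
          have hxC : (⟨(x : WithTop P), Or.inr (Or.inr ⟨x, rfl, hxT⟩)⟩ : ↥(rankSel P ρ T)) ∈ C :=
            hsub (Or.inr (Or.inr ⟨x, hx, rfl⟩))
          have hcomp : x ≤ y ∨ y ≤ x := by
            rcases hC.total hxC hz with h1 | h1
            · left
              have h2 : (x : WithTop P) ≤ z.1 := h1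
              rw [h] at h2
              exact WithTop.coe_le_coe.mp h2
            · right
              have h2 : z.1 ≤ (x : WithTop P) := h1
              rw [h] at h2
              exact WithTop.coe_le_coe.mp h2
          have hxy' : x = y := by
            rcases hcomp with h1 | h1
            · rcases h1.eq_or_lt with h2 | h2
              · exact h2
              · have := aux_strict hsimp h2; omega
            · rcases h1.eq_or_lt with h2 | h2
              · exact h2.symm
              · have := aux_strict hsimp h2; omega
          exact ⟨y, hxy' ▸ hx, h⟩
  unfold alphaP
  rw [himg, Set.ncard_image_of_injOn, Set.ncard_coe_finset]
  have hsub : ∀ F ∈ auxChains ρ (fun _ => True) T, ∀ F', auxPhi ρ T F = auxPhi ρ T F' → F ⊆ F' := by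
    intro F hF F' heq x hx
    simp only [auxChains, Finset.mem_filter, Finset.mem_univ, true_and] at hF
    have hxT : ρ x ∈ T := by rw [← hF.2.1]; exact Finset.mem_image_of_mem _ hx
    have h1 : (⟨(x : WithTop P), Or.inr (Or.inr ⟨x, rfl, hxT⟩)⟩ : ↥(rankSel P ρ T)) ∈
        auxPhi ρ T F := Or.inr (Or.inr ⟨x, hx, rfl⟩)
    rw [heq] at h1
    rcases h1 with h | h | ⟨y, hy, h⟩
    · exact absurd h (WithTop.coe_ne_top)
    · have : x = ⊥ := WithTop.coe_injective h
      subst this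
      have := hT1 _ hxT
      omega
    · have : x = y := WithTop.coe_injective h
      exact this ▸ hy
  intro F hF F' hF' heq
  exact Finset.Subset.antisymm (hsub F hF F' heq) (hsub F' hF' F heq.symm)

end AuxPoset

/-- Let `P` be a graded simplicial poset of rank `n` (finite, with minimum
`⊥`, rank function `ρ` and every interval `[⊥,y]` isomorphic to the Boolean lattice of
subsets of a `ρ(y)`-element set).  Then for every `S ⊆ [n]`,
`β_{P̂}(S) = Σ_{k=0}^n h_k(P) · #{w ∈ S_{n+1} : w(n+1) = k+1, [n] ∖ Des(w) = S}`. -/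
theorem stmt11 (n : ℕ) (P : Type*) [Fintype P] [PartialOrder P] [OrderBot P]
    (ρ : P → ℕ) (hbot : ρ ⊥ = 0) (hcov : ∀ x y : P, x ⋖ y → ρ y = ρ x + 1)
    (hmax : ∀ x : P, IsMax x → ρ x = n)
    (hsimp : ∀ y : P, Nonempty ((Set.Icc (⊥ : P) y) ≃o Finset (Fin (ρ y))))
    (S : Finset ℕ) (hS : S ⊆ Finset.Icc 1 n) :
    betaP P ρ S =
      ∑ k ∈ Finset.range (n + 1), (hpolyP P ρ n).coeff k *
        ((Finset.univ.filter (fun w : Equiv.Perm (Fin (n + 1)) =>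
            (w (Fin.last n) : ℕ) = k ∧ Finset.Icc 1 n \ descSet w = S)).card : ℤ) := by
  have hα : ∀ U ∈ S.powerset, (alphaP P ρ U : ℤ) = ∑ V ∈ U.powerset,
      ∑ k ∈ Finset.range (n + 1), (hpolyP P ρ n).coeff k *
        ((Finset.univ.filter (fun w : Equiv.Perm (Fin (n + 1)) =>
            (w (Fin.last n) : ℕ) = k ∧ Finset.Icc 1 n \ descSet w = V)).card : ℤ) := by
    intro U hU
    have hUn : U ⊆ Finset.Icc 1 n := (Finset.mem_powerset.mp hU).trans hS
    have hsup : U.sup id ≤ n := Finset.sup_le (fun t ht => (Finset.mem_Icc.mp (hUn ht)).2)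
    rw [aux_alpha n hbot hmax hsimp U hUn, aux_chains_all hsimp hbot U, Finset.sum_comm]
    push_cast
    rw [← aux_h P ρ n _ hsup, Finset.sum_mul]
    apply Finset.sum_congr rfl
    intro k hk
    rw [Finset.mem_range] at hk
    rw [← Finset.mul_sum, mul_assoc]
    congr 1
    have hg := auxGam_eq n k (by omega) U
    rw [Finset.inter_eq_left.mpr hUn] at hg
    rw [← Nat.cast_mul, ← hg, ← Nat.cast_sum]
    congr 1
    unfold auxGam
    rw [Finset.card_eq_sum_card_fiberwise
      (f := fun w : Equiv.Perm (Fin (n + 1)) => Finset.Icc 1 n \ descSet w) (t := U.powerset)]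
    · apply Finset.sum_congr rfl
      intro V hV
      congr 1
      ext w
      simp only [Finset.mem_filter, Finset.mem_univ, true_and]
      constructor
      · rintro ⟨⟨a, b⟩, c⟩; exact ⟨a, c⟩
      · rintro ⟨a, c⟩; exact ⟨⟨a, c ▸ Finset.mem_powerset.mp hV⟩, c⟩
    · intro w hw
      simp only [Finset.coe_filter, Finset.mem_univ, true_and, Set.mem_ofPred_eq] at hw
      exact Finset.mem_coe.mpr (Finset.mem_powerset.mpr hw.2)
  unfold betaP
  rw [Finset.sum_congr rfl (fun U hU => by rw [hα U hU])]
  exact aux_mobius S _
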